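/- Let k ∈ ℕ and for each n ∈ ℕ let t^n_1 < … < t^n_n be nonzero integers with |t^n_j| ≥ k for every 1 ≤ j ≤ n. For a nonzero integer t, let c_t = (-1)^{-t}/((-t+1)!) if t < 0 and c_t = (-1)^{t+1}·t! if t > 0, and set ℚ(t^n_1,…,t^n_n,k) = {Σ_{j=1}^n q_j·c_{t^n_j} : 1 ≤ q_j ≤ k}. If A ⊆ ℚ satisfies limsup_n |A ∩ ℚ(t^n_1,…,t^n_n,k)| / k^n > 0, then there exist n ∈ ℕ, disjoint sets F_1, F_2 ⊆ {t^n_1,…,t^n_n} with F_2 nonempty, and integers (w_t)_{t∈F_1} with 1 ≤ w_t ≤ k, such that, setting q = Σ_{t∈F_2} c_t and p = q + Σ_{t∈F_1} w_t·c_t, one has q ≠ 0, p ∈ A, and p + i·q ∈ A for every i = 0, 1, …, k−1. In particular A contains an arithmetic progression of length k whose terms p and common difference q have domains contained in {t^n_1,…,t^n_n}. -/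

import Mathlib

/-- The coefficient `c_t` attached to a nonzero integer index `t`:
`c_t = (-1)^{-t}/((-t+1)!)` for `t < 0` and `c_t = (-1)^{t+1}·t!` for `t > 0`. -/
def ratCoeff (t : ℤ) : ℚ :=
  if t < 0 then (-1 : ℚ) ^ (-t).toNat / ((-t).toNat + 1).factorial
  else (-1 : ℚ) ^ (t.toNat + 1) * (t.toNat).factorial

noncomputable def avg {X : Type} [Finite X] (f : X → ℝ) : ℝ := (∑ᶠ x, f x) / Nat.card X

open Classical in
noncomputable def ind (p : Prop) : ℝ := if p then 1 else 0

namespace DHJ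

lemma ind_true {p : Prop} (h : p) : ind p = 1 := by simp [ind, h]
lemma ind_false {p : Prop} (h : ¬ p) : ind p = 0 := by simp [ind, h]
lemma ind_nonneg (p : Prop) : 0 ≤ ind p := by unfold ind; split_ifs <;> norm_num
lemma ind_le_one (p : Prop) : ind p ≤ 1 := by unfold ind; split_ifs <;> norm_num
lemma ind_mono {p q : Prop} (h : p → q) : ind p ≤ ind q := by
  by_cases hp : p
  · rw [ind_true hp, ind_true (h hp)]
  · rw [ind_false hp]; exact ind_nonneg q
lemma ind_congr {p q : Prop} (h : p ↔ q) : ind p = ind q := by rw [propext h]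
lemma ind_and (p q : Prop) : ind (p ∧ q) = ind p * ind q := by
  by_cases hp : p <;> by_cases hq : q <;> simp [ind, hp, hq]
lemma ind_not (p : Prop) : ind (¬ p) = 1 - ind p := by
  by_cases hp : p <;> simp [ind, hp]

section
variable {X Y : Type} [Finite X] [Finite Y]

lemma avg_eq {X : Type} [Fintype X] (f : X → ℝ) : avg f = (∑ x, f x) / Fintype.card X := by
  rw [avg, finsum_eq_sum_of_fintype, Nat.card_eq_fintype_card]

lemma avg_mono {f g : X → ℝ} (h : ∀ x, f x ≤ g x) : avg f ≤ avg g := by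
  have := Fintype.ofFinite X
  rw [avg_eq, avg_eq]
  gcongr with x
  exact h x

lemma avg_congr {f g : X → ℝ} (h : ∀ x, f x = g x) : avg f = avg g := by
  rw [funext h]

lemma avg_add (f g : X → ℝ) : avg (fun x => f x + g x) = avg f + avg g := by
  have := Fintype.ofFinite X
  rw [avg_eq, avg_eq, avg_eq, Finset.sum_add_distrib, add_div]

lemma avg_sub (f g : X → ℝ) : avg (fun x => f x - g x) = avg f - avg g := by
  have := Fintype.ofFinite X
  rw [avg_eq, avg_eq, avg_eq, Finset.sum_sub_distrib, sub_div]

lemma avg_mul_left (c : ℝ) (f : X → ℝ) : avg (fun x => c * f x) = c * avg f := by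
  have := Fintype.ofFinite X
  rw [avg_eq, avg_eq, ← Finset.mul_sum, mul_div_assoc]

lemma avg_mul_right (c : ℝ) (f : X → ℝ) : avg (fun x => f x * c) = avg f * c := by
  rw [mul_comm, ← avg_mul_left]; exact avg_congr fun x => mul_comm _ _

lemma avg_const [Nonempty X] (c : ℝ) : avg (fun _ : X => c) = c := by
  have := Fintype.ofFinite X
  rw [avg_eq]
  simp

lemma avg_equiv (e : X ≃ Y) (f : Y → ℝ) : avg (fun x => f (e x)) = avg f := by
  have := Fintype.ofFinite X
  have := Fintype.ofFinite Y
  rw [avg_eq, avg_eq, Fintype.card_congr e, Equiv.sum_comp e]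

lemma avg_prod (f : X → Y → ℝ) :
    avg (fun p : X × Y => f p.1 p.2) = avg fun x => avg fun y => f x y := by
  have := Fintype.ofFinite X
  have := Fintype.ofFinite Y
  simp only [avg_eq, Fintype.card_prod, Fintype.sum_prod_type, ← Finset.sum_div, Nat.cast_mul]
  rw [div_div, mul_comm]

lemma avg_comm (f : X → Y → ℝ) :
    (avg fun x => avg fun y => f x y) = avg fun y => avg fun x => f x y := by
  rw [← avg_prod, ← avg_prod, ← avg_equiv (Equiv.prodComm X Y)]
  rfl

lemma avg_sum {L : Type} [Fintype L] (f : L → X → ℝ) :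
    avg (fun x => ∑ l, f l x) = ∑ l, avg (f l) := by
  have := Fintype.ofFinite X
  simp only [avg_eq]
  rw [Finset.sum_comm, Finset.sum_div]

lemma avg_le_const [Nonempty X] {f : X → ℝ} {c : ℝ} (h : ∀ x, f x ≤ c) : avg f ≤ c := by
  rw [← avg_const (X := X) c]; exact avg_mono h

lemma const_le_avg [Nonempty X] {f : X → ℝ} {c : ℝ} (h : ∀ x, c ≤ f x) : c ≤ avg f := by
  rw [← avg_const (X := X) c]; exact avg_mono h

lemma avg_nonneg {f : X → ℝ} (h : ∀ x, 0 ≤ f x) : 0 ≤ avg f := by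
  have := Fintype.ofFinite X
  rw [avg_eq]
  exact div_nonneg (Finset.sum_nonneg fun x _ => h x) (Nat.cast_nonneg _)

lemma exists_avg_le [Nonempty X] (f : X → ℝ) : ∃ x, avg f ≤ f x := by
  by_contra! h
  have := Fintype.ofFinite X
  have h2 : ∑ x, f x < ∑ x : X, avg f :=
    Finset.sum_lt_sum_of_nonempty Finset.univ_nonempty fun x _ => h x
  rw [Finset.sum_const, nsmul_eq_mul, avg_eq, Finset.card_univ] at h2
  have : (0:ℝ) < Fintype.card X := by exact_mod_cast Fintype.card_pos
  rw [mul_div_cancel₀ _ this.ne'] at h2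
  exact lt_irrefl _ h2

lemma card_pos' (X : Type) [Finite X] [Nonempty X] : (0:ℝ) < Nat.card X := by
  exact_mod_cast Nat.card_pos

lemma le_card_mul_avg [Nonempty X] {f : X → ℝ} (h : ∀ x, 0 ≤ f x) (x : X) :
    f x ≤ Nat.card X * avg f := by
  have := Fintype.ofFinite X
  have hc := card_pos' X
  rw [avg_eq, ← Nat.card_eq_fintype_card, mul_div_cancel₀ _ hc.ne']
  exact Finset.single_le_sum (fun x _ => h x) (Finset.mem_univ x)

lemma avg_lower [Nonempty X] {f : X → ℝ} {u v : ℝ} (h : ∀ x, f x ≤ u) (hv : v ≤ avg f) (x : X) :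
    u - Nat.card X * (u - v) ≤ f x := by
  have h1 := le_card_mul_avg (f := fun x => u - f x) (fun x => sub_nonneg.2 (h x)) x
  rw [avg_sub, avg_const] at h1
  have hc := card_pos' X
  nlinarith

lemma avg_range_nonpos {φ : Y → X} (hφ : Function.Injective φ) (h : X → ℝ)
    (hh : avg (fun y => h (φ y)) ≤ 0) : avg (fun x => ind (∃ y, φ y = x) * h x) ≤ 0 := by
  classical
  have := Fintype.ofFinite X
  have := Fintype.ofFinite Y
  rw [avg_eq] at *
  have key : ∑ x, ind (∃ y, φ y = x) * h x = ∑ y, h (φ y) := by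
    rw [← Finset.sum_image (s := Finset.univ) (g := φ) (f := h) (fun a _ b _ hab => hφ hab)]
    rw [← Finset.sum_subset (Finset.subset_univ (Finset.univ.image φ))]
    · refine Finset.sum_congr rfl fun x hx => ?_
      rw [ind_true, one_mul]
      simpa using hx
    · intro x _ hx
      rw [ind_false, zero_mul]
      simpa using hx
  rw [key]
  rcases isEmpty_or_nonempty Y with hY | hY
  · simp
  · have hc : (0:ℝ) < Fintype.card Y := by exact_mod_cast Fintype.card_pos
    have : ∑ y, h (φ y) ≤ 0 := by
      by_contra! hcon
      exact absurd hh (not_le.2 (div_pos hcon hc))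
    exact div_nonpos_of_nonpos_of_nonneg this (Nat.cast_nonneg _)

lemma avg_sum_elim {ι κ β : Type} [Finite ι] [Finite κ] [Finite β] (f : (ι ⊕ κ → β) → ℝ) :
    avg f = avg fun x : ι → β => avg fun y : κ → β => f (Sum.elim x y) := by
  rw [← avg_prod, ← avg_equiv (Equiv.sumArrowEquivProdArrow ι κ β).symm]
  rfl

/-- Averaging plus pigeonhole. -/
lemma pigeon [Nonempty X] [Nonempty Y] {L : Type} [Finite L] (S : L → X → Prop)
    (A : X → Y → Prop) {ε : ℝ} (hε : 0 < ε)
    (hA : ε ≤ avg fun x => avg fun y => ind (A x y))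
    (hS : ∀ y, ε / 2 ≤ avg (fun x => ind (A x y)) → ∃ l, ∀ x, S l x → A x y) :
    ∃ l, ε / 2 / (Nat.card L + 1) ≤ avg fun y => ind (∀ x, S l x → A x y) := by
  have := Fintype.ofFinite L
  by_contra! hcon
  rw [avg_comm] at hA
  have h1 : ∀ y, (avg fun x => ind (A x y)) ≤ ε / 2 + ∑ l, ind (∀ x, S l x → A x y) := by
    intro y
    have hs : 0 ≤ ∑ l, ind (∀ x, S l x → A x y) := Finset.sum_nonneg fun l _ => ind_nonneg _
    by_cases hy : ε / 2 ≤ avg fun x => ind (A x y)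
    · obtain ⟨l, hl⟩ := hS _ hy
      have h2 : ind (∀ x, S l x → A x y) ≤ ∑ l, ind (∀ x, S l x → A x y) :=
        Finset.single_le_sum (f := fun l => ind (∀ x, S l x → A x y))
          (fun l _ => ind_nonneg _) (Finset.mem_univ l)
      rw [ind_true hl] at h2
      have h3 : (avg fun x => ind (A x y)) ≤ 1 := avg_le_const fun x => ind_le_one _
      linarith
    · linarith
  have h2 := hA.trans (avg_mono h1)
  rw [avg_add, avg_const, avg_sum] at h2
  have h3 : ∑ l, avg (fun y => ind (∀ x, S l x → A x y)) ≤
      ∑ l : L, ε / 2 / (Nat.card L + 1) := Finset.sum_le_sum fun l _ => (hcon l).le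
  rw [Finset.sum_const, nsmul_eq_mul, Finset.card_univ, ← Nat.card_eq_fintype_card] at h3
  have hc : (0:ℝ) < (Nat.card L : ℝ) + 1 := by positivity
  have h4 : (Nat.card L : ℝ) * (ε / 2 / (Nat.card L + 1)) < ε / 2 := by
    rw [mul_div_assoc', div_lt_iff₀ hc]
    nlinarith
  linarith

end
end DHJ

namespace DHJ
open Combinatorics

lemma avg_pi_prod {ι γ : Type} [Fintype ι] [Finite γ] (φ : ι → γ → ℝ) :
    avg (fun x : ι → γ => ∏ i, φ i (x i)) = ∏ i, avg (φ i) := by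
  classical
  have := Fintype.ofFinite γ
  simp only [avg_eq, Finset.prod_div_distrib]
  rw [Finset.prod_univ_sum, Fintype.piFinset_univ]
  simp

lemma avg_ind_lt_one {X : Type} [Finite X] (p : X → Prop) (x : X) (hx : ¬ p x) :
    avg (fun x => ind (p x)) < 1 := by
  have : Nonempty X := ⟨x⟩
  have h := le_card_mul_avg (f := fun x => ind (¬ p x)) (fun x => ind_nonneg _) x
  have hc := card_pos' X
  simp only [ind_not] at h
  rw [avg_sub, avg_const, ind_false hx] at h
  by_contra! hcon
  nlinarith

lemma ind_forall_prod {ι : Type} [Fintype ι] (p : ι → Prop) : ind (∀ i, p i) = ∏ i, ind (p i) := by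
  by_cases h : ∀ i, p i
  · rw [ind_true h]; exact (Finset.prod_eq_one fun i _ => ind_true (h i)).symm
  · rw [ind_false h]; push Not at h; obtain ⟨i, hi⟩ := h
    exact (Finset.prod_eq_zero (Finset.mem_univ i) (ind_false hi)).symm

def DHJProp (α : Type) [Finite α] : Prop :=
  ∀ δ : ℝ, 0 < δ → ∃ (ι : Type) (_ : Finite ι), ∀ A : (ι → α) → Prop,
    δ ≤ avg (fun x => ind (A x)) → ∃ l : Line α ι, ∀ a, A (l a)

lemma avg_extend {α ι κ : Type} [Finite α] [Nonempty α] [Finite ι] [Finite κ] (e : ι → κ)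
    (he : Function.Injective e) (f : (κ → α) → ℝ) :
    (avg fun w : κ → α => avg fun u : ι → α => f (Function.extend e u w)) = avg f := by
  let σ : (κ → α) × (ι → α) → (κ → α) × (ι → α) := fun p => (Function.extend e p.2 p.1, p.1 ∘ e)
  have hσ : Function.Involutive σ := by
    rintro ⟨w, u⟩
    simp only [σ, Prod.mk.injEq]
    constructor
    · funext i
      by_cases hi : ∃ j, e j = i
      · obtain ⟨j, rfl⟩ := hi
        rw [he.extend_apply]; rfl
      · rw [Function.extend_apply' _ _ _ hi, Function.extend_apply' _ _ _ hi]
    · funext j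
      simp [he.extend_apply]
  rw [← avg_prod]
  have := avg_equiv hσ.toPerm (fun p : (κ → α) × (ι → α) => f p.1)
  rw [avg_prod (fun x _ => f x)] at this
  simp only [avg_const] at this
  rw [← this]
  rfl

lemma dhj_emb {α ι κ : Type} [Finite α] [Nonempty α] [Finite ι] [Finite κ] {δ : ℝ}
    (hι : ∀ A : (ι → α) → Prop, δ ≤ avg (fun x => ind (A x)) → ∃ l : Line α ι, ∀ a, A (l a))
    (e : ι → κ) (he : Function.Injective e) (A : (κ → α) → Prop)
    (hA : δ ≤ avg (fun x => ind (A x))) :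
    ∃ l : Line α κ, (∀ a, A (l a)) ∧ ∀ i, l.idxFun i = none → ∃ j, e j = i := by
  rw [← avg_extend e he] at hA
  obtain ⟨w, hw⟩ := exists_avg_le (fun w : κ → α => avg fun u : ι → α =>
    ind (A (Function.extend e u w)))
  obtain ⟨l, hl⟩ := hι _ (hA.trans hw)
  refine ⟨⟨Function.extend e l.idxFun (fun i => some (w i)), ?_⟩, ?_, ?_⟩
  · obtain ⟨i, hi⟩ := l.proper
    exact ⟨e i, by rw [he.extend_apply, hi]⟩
  · intro a
    convert hl a using 1
    funext i
    by_cases hi : ∃ j, e j = i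
    · obtain ⟨j, rfl⟩ := hi
      simp [he.extend_apply]
    · simp [Function.extend_apply' _ _ _ hi]
  · intro i hi
    by_contra hcon
    simp [Function.extend_apply' _ _ _ hcon] at hi

lemma avg_merge {α κ : Type} [Finite α] [Nonempty α] [Finite κ] (f : (κ → Option α) → ℝ) :
    (avg fun v : κ → Option α => avg fun w : κ → α => f (fun i => (v i).map (fun _ => w i)))
      = avg f := by
  let σ : (κ → Option α) × (κ → α) → (κ → Option α) × (κ → α) :=
    fun p => (fun i => (p.1 i).map (fun _ => p.2 i), fun i => (p.1 i).getD (p.2 i))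
  have hσ : Function.Involutive σ := by
    rintro ⟨v, w⟩
    simp only [σ, Prod.mk.injEq]
    constructor
    · funext i
      cases h : v i <;> simp
    · funext i
      cases h : v i <;> simp
  rw [← avg_prod]
  have := avg_equiv hσ.toPerm (fun p : (κ → Option α) × (κ → α) => f p.1)
  rw [avg_prod (fun x _ => f x)] at this
  simp only [avg_const] at this
  rw [← this]
  rfl

lemma avg_block {ι γ : Type} [Finite ι] [Finite γ] [Nonempty γ] (s : ℕ) (p : γ → Prop) (i : ι) :
    avg (fun v : ι × Fin s → γ => ind (∀ f, p (v (i, f)))) = (avg fun b => ind (p b)) ^ s := by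
  classical
  have := Fintype.ofFinite ι
  have h1 : ∀ v : ι × Fin s → γ, ind (∀ f, p (v (i, f))) =
      ∏ q : ι × Fin s, (if q.1 = i then ind (p (v q)) else 1) := by
    intro v
    rw [ind_forall_prod, Fintype.prod_prod_type, Finset.prod_eq_single i]
    · simp
    · intro b _ hb; simp [hb]
    · simp
  rw [avg_congr h1, avg_pi_prod (fun (q : ι × Fin s) b => if q.1 = i then ind (p b) else 1),
    Fintype.prod_prod_type, Finset.prod_eq_single i]
  · simp
  · intro b _ hb; simp [hb, avg_const]
  · simp

lemma q1 {α : Type} [Finite α] [Nonempty α] (H : DHJProp α) (ε : ℝ) (hε : 0 < ε) :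
    ∃ (κ : Type) (_ : Finite κ), ∀ A : (κ → Option α) → Prop, ε ≤ avg (fun x => ind (A x)) →
      ∃ l : Line (Option α) κ, ∀ a : α, A (l (some a)) := by
  obtain ⟨ι, _, hι⟩ := H (ε / 2) (by linarith)
  have := Fintype.ofFinite ι
  set c := avg (fun b : Option α => ind (b = none)) with hc
  have hc1 : c < 1 := avg_ind_lt_one _ (some (Classical.arbitrary α)) (by simp)
  have hc0 : 0 ≤ c := avg_nonneg fun _ => ind_nonneg _
  obtain ⟨s, hs⟩ := exists_pow_lt_of_lt_one (show 0 < ε / 2 / (Fintype.card ι + 1) by positivity) hc1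
  refine ⟨ι × Fin s, inferInstance, fun A hA => ?_⟩
  rw [← avg_merge] at hA
  have : ∃ v : ι × Fin s → Option α, (∀ i, ∃ f, v (i, f) ≠ none) ∧
      ε / 2 ≤ avg fun w : ι × Fin s → α => ind (A (fun i => (v i).map (fun _ => w i))) := by
    by_contra! hcon
    have h1 : ∀ v : ι × Fin s → Option α,
        (avg fun w : ι × Fin s → α => ind (A (fun i => (v i).map (fun _ => w i)))) ≤
        ε / 2 + ∑ i, ind (∀ f, v (i, f) = none) := by
      intro v
      by_cases hv : ∀ i, ∃ f, v (i, f) ≠ none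
      · have := hcon v hv
        have h0 : 0 ≤ ∑ i, ind (∀ f, v (i, f) = none) := Finset.sum_nonneg fun _ _ => ind_nonneg _
        linarith
      · push Not at hv
        obtain ⟨i, hi⟩ := hv
        have h2 : ind (∀ f, v (i, f) = none) ≤ ∑ i, ind (∀ f, v (i, f) = none) :=
          Finset.single_le_sum (f := fun i => ind (∀ f, v (i, f) = none))
          (fun l _ => ind_nonneg _) (Finset.mem_univ i)
        rw [ind_true hi] at h2
        have h3 : (avg fun w : ι × Fin s → α => ind (A (fun i => (v i).map (fun _ => w i)))) ≤ 1 :=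
          avg_le_const fun x => ind_le_one _
        linarith
    have h2 := hA.trans (avg_mono h1)
    rw [avg_add, avg_const, avg_sum] at h2
    have h3 : ∀ i : ι, avg (fun v : ι × Fin s → Option α => ind (∀ f, v (i, f) = none)) = c ^ s :=
      fun i => avg_block s (fun b : Option α => b = none) i
    simp only [h3, Finset.sum_const, nsmul_eq_mul, Finset.card_univ] at h2
    have hpos : (0:ℝ) < (Fintype.card ι : ℝ) + 1 := by positivity
    rw [lt_div_iff₀ hpos] at hs
    have : 0 ≤ c ^ s := pow_nonneg hc0 s
    by_cases hz : c ^ s = 0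
    · rw [hz] at h2; linarith
    · have : 0 < c ^ s := lt_of_le_of_ne this (Ne.symm hz)
      nlinarith
  obtain ⟨v, hv, hvA⟩ := this
  choose f hf using hv
  obtain ⟨l, hl, hlr⟩ := dhj_emb hι (fun i => (i, f i)) (fun i j h => (Prod.mk.inj h).1) _ hvA
  refine ⟨⟨fun p => (v p).elim (some none) (fun _ => (l.idxFun p).map some), ?_⟩, ?_⟩
  · obtain ⟨p, hp⟩ := l.proper
    obtain ⟨i, rfl⟩ := hlr p hp
    refine ⟨(i, f i), ?_⟩
    obtain ⟨b, hb⟩ := Option.ne_none_iff_exists'.1 (hf i)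
    simp [hb, hp]
  · intro a
    convert hl a using 1
    funext p
    cases h : v p with
    | none => simp [h]
    | some b => cases h2 : l.idxFun p <;> simp [h, h2]

instance {η α ι : Type} [Finite η] [Finite α] [Finite ι] : Finite (Subspace η α ι) :=
  Finite.of_injective (fun V => V.idxFun) fun _ _ h => Subspace.ext h

instance {α ι : Type} [Finite α] [Finite ι] : Finite (Line α ι) :=
  Finite.of_injective (fun V => V.idxFun) fun _ _ h => Line.ext h

lemma qη {α : Type} [Finite α] [Nonempty α] (H : DHJProp α) (η : Type) [Finite η] :
    ∀ ε : ℝ, 0 < ε →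
    ∃ (κ : Type) (_ : Finite κ), ∀ A : (κ → Option α) → Prop, ε ≤ avg (fun x => ind (A x)) →
      ∃ V : Subspace η (Option α) κ, ∀ z : η → α, A (V fun i => some (z i)) := by
  revert η
  refine fun η hη => Finite.induction_empty_option (P := fun η => ∀ ε : ℝ, 0 < ε →
    ∃ (κ : Type) (_ : Finite κ), ∀ A : (κ → Option α) → Prop, ε ≤ avg (fun x => ind (A x)) →
      ∃ V : Subspace η (Option α) κ, ∀ z : η → α, A (V fun i => some (z i))) ?_ ?_ ?_ η
  · intro η η' e h ε hε
    obtain ⟨κ, i1, hκ⟩ := h ε hε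
    refine ⟨κ, i1, fun A hA => ?_⟩
    obtain ⟨V, hV⟩ := hκ A hA
    refine ⟨V.reindex e (Equiv.refl _) (Equiv.refl _), fun z => ?_⟩
    convert hV (z ∘ e) using 1
    funext i
    simp
    rfl
  · intro ε hε
    refine ⟨Unit, inferInstance, fun A hA => ?_⟩
    obtain ⟨x, hx⟩ := exists_avg_le (fun x : Unit → Option α => ind (A x))
    have hAx : A x := by
      by_contra hcon
      rw [ind_false hcon] at hx
      linarith
    exact ⟨⟨fun i => Sum.inl (x i), fun e => e.elim⟩, fun z => hAx⟩
  · intro η _ h ε hε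
    obtain ⟨κ₁, _, h1⟩ := q1 H (ε / 2) (by linarith)
    obtain ⟨κ₂, _, h2⟩ := h (ε / 2 / (Nat.card (Line (Option α) κ₁) + 1)) (by positivity)
    refine ⟨κ₁ ⊕ κ₂, inferInstance, fun A hA => ?_⟩
    rw [avg_sum_elim] at hA
    obtain ⟨l, hl⟩ := pigeon (fun (l : Line (Option α) κ₁) x => ∃ a : α, x = l (some a))
      (fun x y => A (Sum.elim x y)) hε hA (fun y hB => by
        obtain ⟨l, hl⟩ := h1 _ hB
        exact ⟨l, by rintro x ⟨a, rfl⟩; exact hl a⟩)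
    obtain ⟨V, hV⟩ := h2 _ hl
    refine ⟨⟨Sum.elim (fun i => (l.idxFun i).elim (Sum.inr none) Sum.inl)
      (fun j => (V.idxFun j).map id some), ?_⟩, ?_⟩
    · intro e
      cases e with
      | none =>
        obtain ⟨i, hi⟩ := l.proper
        exact ⟨Sum.inl i, by simp [hi]⟩
      | some e =>
        obtain ⟨i, hi⟩ := V.proper e
        exact ⟨Sum.inr i, by simp [hi]⟩
    · intro z
      convert hV (fun e => z (some e)) _ ⟨z none, rfl⟩ using 1
      funext i
      cases i with
      | inl i => cases h : l.idxFun i <;> simp [Subspace.apply_def, h]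
      | inr i => cases h : V.idxFun i <;> simp [Subspace.apply_def, h]

/-- `D` is insensitive to exchanging the letters `some r` and `none`. -/
def Insens {α ι : Type} (r : α) (D : (ι → Option α) → Prop) : Prop :=
  ∀ y y' : ι → Option α, (∀ i, (y i).getD r = (y' i).getD r) → D y → D y'

lemma insSub {α : Type} [Finite α] [Nonempty α] (H : DHJProp α) (r : α) (η : Type) [Finite η]
    (ε : ℝ) (hε : 0 < ε) :
    ∃ (κ : Type) (_ : Finite κ), ∀ D : (κ → Option α) → Prop, Insens r D →
      ε ≤ avg (fun x => ind (D x)) →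
      ∃ V : Subspace η (Option α) κ, ∀ z : η → Option α, D (V z) := by
  obtain ⟨κ, i1, hκ⟩ := qη H η ε hε
  refine ⟨κ, i1, fun D hD hA => ?_⟩
  obtain ⟨V, hV⟩ := hκ D hA
  refine ⟨V, fun z => hD _ _ ?_ (hV fun e => (z e).getD r)⟩
  intro i
  cases h : V.idxFun i <;> simp [Subspace.apply_def, h]

end DHJ

namespace DHJ
open Combinatorics

section helpers
variable {η ζ β ι κ : Type}

def vert (x : κ → β) (V : Subspace η β ι) : Subspace η β (κ ⊕ ι) :=
  ⟨Sum.elim (fun i => Sum.inl (x i)) V.idxFun, fun e =>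
    let ⟨i, hi⟩ := V.proper e; ⟨Sum.inr i, hi⟩⟩

lemma vert_apply (x : κ → β) (V : Subspace η β ι) (z : η → β) :
    vert x V z = Sum.elim x (V z) := by
  funext i; cases i <;> rfl

def horiz (V : Subspace η β ι) (y : κ → β) : Subspace η β (ι ⊕ κ) :=
  ⟨Sum.elim V.idxFun (fun i => Sum.inl (y i)), fun e =>
    let ⟨i, hi⟩ := V.proper e; ⟨Sum.inl i, hi⟩⟩

lemma horiz_apply (V : Subspace η β ι) (y : κ → β) (z : η → β) :
    horiz V y z = Sum.elim (V z) y := by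
  funext i; cases i <;> rfl

def scomp (V : Subspace η β ι) (U : Subspace ζ β η) : Subspace ζ β ι :=
  ⟨fun i => (V.idxFun i).elim Sum.inl U.idxFun, fun e => by
    obtain ⟨j, hj⟩ := U.proper e
    obtain ⟨i, hi⟩ := V.proper j
    exact ⟨i, by simp [hi, hj]⟩⟩

lemma scomp_apply (V : Subspace η β ι) (U : Subspace ζ β η) (z : ζ → β) :
    scomp V U z = V (U z) := by
  funext i
  cases h : V.idxFun i <;> simp [Subspace.apply_def, scomp, h]

lemma sub_inj (V : Subspace η β ι) : Function.Injective (fun z => V z) := by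
  intro z z' h
  funext e
  obtain ⟨i, hi⟩ := V.proper e
  have := congrFun h i
  simpa [Subspace.apply_def, hi] using this

end helpers

lemma Insens.not {α ι : Type} {r : α} {D : (ι → Option α) → Prop} (h : Insens r D) :
    Insens r (fun x => ¬ D x) := fun _ _ hy hn hD => hn (h _ _ (fun i => (hy i).symm) hD)

lemma Insens.sub {α ι η : Type} {r : α} {D : (ι → Option α) → Prop} (h : Insens r D)
    (V : Subspace η (Option α) ι) : Insens r (fun z => D (V z)) := by
  intro y y' hy hD
  refine h _ _ (fun i => ?_) hD
  cases h : V.idxFun i with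
  | inl b => simp [Subspace.apply_def, h]
  | inr e => simpa [Subspace.apply_def, h] using hy e

lemma ins0 {α : Type} [Finite α] [Nonempty α] (H : DHJProp α) (r : α) (η : Type) [Finite η]
    (ε : ℝ) (hε : 0 < ε) :
    ∃ (κ : Type) (_ : Finite κ), ∀ g : (κ → Option α) → ℝ, (∀ x, g x ≤ 1) →
      (∀ V : Subspace η (Option α) κ, avg (fun z => g (V z)) ≤ 0) →
      ∀ D : (κ → Option α) → Prop, Insens r D → avg (fun x => ind (D x) * g x) ≤ ε := by
  obtain ⟨M, _, hM⟩ := insSub H r η (ε / 2 / 2) (by positivity)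
  set θ := ε / 2 / 2 / (Nat.card (Subspace η (Option α) M) + 1) with hθ
  have hθ0 : 0 < θ := by positivity
  have hcM := card_pos' (M → Option α)
  set μ := θ / Nat.card (M → Option α) with hμ
  have hμ0 : 0 < μ := by positivity
  set lam := max 0 (1 - μ) with hlam
  have hl0 : 0 ≤ lam := le_max_left _ _
  have hl1 : lam < 1 := max_lt one_pos (by linarith)
  have hl2 : 1 - μ ≤ lam := le_max_right _ _
  have claim : ∀ T : ℕ, ∃ (κ : Type) (_ : Finite κ), ∀ g : (κ → Option α) → ℝ, (∀ x, g x ≤ 1) →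
      (∀ V : Subspace η (Option α) κ, avg (fun z => g (V z)) ≤ 0) →
      ∀ D : (κ → Option α) → Prop, Insens r D →
        avg (fun x => ind (D x) * g x) ≤ ε / 2 + lam ^ T * avg (fun x => ind (D x)) := by
    intro T
    induction T with
    | zero =>
      refine ⟨Unit, inferInstance, fun g hg _ D _ => ?_⟩
      have : avg (fun x => ind (D x) * g x) ≤ avg (fun x => ind (D x)) :=
        avg_mono fun x => mul_le_of_le_one_right (ind_nonneg _) (hg x)
      rw [pow_zero]
      linarith
    | succ T ih =>
      obtain ⟨κ, _, hκ⟩ := ih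
      refine ⟨M ⊕ κ, inferInstance, fun g hg hV D hD => ?_⟩
      have hd0 : 0 ≤ avg (fun x => ind (D x)) := avg_nonneg fun _ => ind_nonneg _
      have hd1 : avg (fun x => ind (D x)) ≤ 1 := avg_le_const fun _ => ind_le_one _
      by_cases hd : avg (fun x => ind (D x)) < ε / 2
      · have : avg (fun x => ind (D x) * g x) ≤ avg (fun x => ind (D x)) :=
          avg_mono fun x => mul_le_of_le_one_right (ind_nonneg _) (hg x)
        have : 0 ≤ lam ^ (T + 1) * avg (fun x => ind (D x)) := by positivity
        linarith
      · push Not at hd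
        have hd' := hd
        rw [avg_sum_elim] at hd'
        obtain ⟨V, hVE⟩ := pigeon (fun (V : Subspace η (Option α) M) x => ∃ z, x = V z)
          (fun x y => D (Sum.elim x y)) (by positivity) hd' (fun y hB => by
            obtain ⟨V, hV⟩ := hM (fun x => D (Sum.elim x y)) (by
              intro x x' hx hDx
              refine hD _ _ ?_ hDx
              rintro (i | i)
              · exact hx i
              · rfl) hB
            exact ⟨V, by rintro x ⟨a, rfl⟩; exact hV a⟩)
        set E : (κ → Option α) → Prop := fun y => ∀ x, (∃ z, x = V z) → D (Sum.elim x y) with hE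
        have hEi : Insens r E := by
          intro y y' hy hEy x hx
          refine hD _ _ ?_ (hEy x hx)
          rintro (i | i)
          · rfl
          · exact hy i
        set R : (M → Option α) → Prop := fun x => ∃ z, V z = x with hR
        set D' : (M → Option α) → (κ → Option α) → Prop :=
          fun x y => D (Sum.elim x y) ∧ ¬ (R x ∧ E y) with hD'
        have hDi : ∀ x, Insens r (D' x) := by
          intro x y y' hy hDy
          refine ⟨hD _ _ ?_ hDy.1, fun h => hDy.2 ⟨h.1, hEi _ _ (fun i => (hy i).symm) h.2⟩⟩
          rintro (i | i)
          · rfl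
          · exact hy i
        have hsplit : ∀ x y, ind (D (Sum.elim x y)) = ind (E y) * ind (R x) + ind (D' x y) := by
          intro x y
          by_cases h1 : R x ∧ E y
          · have h2 : D (Sum.elim x y) := by
              obtain ⟨⟨z, hz⟩, h⟩ := h1
              exact h x ⟨z, hz.symm⟩
            rw [ind_true h2, ind_true h1.1, ind_true h1.2, ind_false (fun h : D' x y => h.2 h1)]
            norm_num
          · have h2 : ind (E y) * ind (R x) = 0 := by
              rw [← ind_and, ind_false]; tauto
            rw [h2, zero_add]
            exact ind_congr ⟨fun h => ⟨h, h1⟩, fun h => h.1⟩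
        have e1 : avg (fun x => ind (D x) * g x) =
            (avg fun y => ind (E y) * avg fun x => ind (R x) * g (Sum.elim x y)) +
            avg fun x => avg fun y => ind (D' x y) * g (Sum.elim x y) := by
          rw [avg_sum_elim]
          have : ∀ x, (avg fun y => ind (D (Sum.elim x y)) * g (Sum.elim x y)) =
              (avg fun y => ind (E y) * (ind (R x) * g (Sum.elim x y))) +
              avg fun y => ind (D' x y) * g (Sum.elim x y) := by
            intro x
            rw [← avg_add]
            refine avg_congr fun y => ?_
            rw [hsplit]; ring
          rw [avg_congr this, avg_add, avg_comm]
          simp only [avg_mul_left]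
        have e2 : avg (fun x => ind (D x)) =
            avg (fun y => ind (E y)) * avg (fun x => ind (R x)) +
            avg fun x => avg fun y => ind (D' x y) := by
          rw [avg_sum_elim]
          have : ∀ x, (avg fun y => ind (D (Sum.elim x y))) =
              avg (fun y => ind (E y)) * ind (R x) + avg fun y => ind (D' x y) := by
            intro x
            rw [← avg_mul_right, ← avg_add]
            exact avg_congr fun y => hsplit x y
          rw [avg_congr this, avg_add, avg_mul_left]
        have b1 : (avg fun y => ind (E y) * avg fun x => ind (R x) * g (Sum.elim x y)) ≤ 0 := by
          refine avg_le_const fun y => ?_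
          refine mul_nonpos_of_nonneg_of_nonpos (ind_nonneg _) ?_
          refine avg_range_nonpos (sub_inj V) (fun x => g (Sum.elim x y)) ?_
          have := hV (horiz V y)
          simpa only [horiz_apply] using this
        have b2 : (avg fun x => avg fun y => ind (D' x y) * g (Sum.elim x y)) ≤
            ε / 2 + lam ^ T * avg fun x => avg fun y => ind (D' x y) := by
          have : ∀ x, (avg fun y => ind (D' x y) * g (Sum.elim x y)) ≤
              ε / 2 + lam ^ T * avg fun y => ind (D' x y) := by
            intro x
            refine hκ (fun y => g (Sum.elim x y)) (fun y => hg _) (fun U => ?_) (D' x) (hDi x)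
            have := hV (vert x U)
            simpa only [vert_apply] using this
          refine (avg_mono this).trans (le_of_eq ?_)
          rw [avg_add, avg_const, avg_mul_left]
        have b3 : μ ≤ avg (fun y => ind (E y)) * avg (fun x => ind (R x)) := by
          have h1 := le_card_mul_avg (f := fun x => ind (R x)) (fun _ => ind_nonneg _)
            (V fun _ => none)
          rw [ind_true ⟨_, rfl⟩] at h1
          have h2 : 1 / (Nat.card (M → Option α) : ℝ) ≤ avg (fun x => ind (R x)) := by
            rw [div_le_iff₀ hcM]; linarith
          calc μ = θ * (1 / (Nat.card (M → Option α) : ℝ)) := by rw [hμ]; ring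
            _ ≤ _ := mul_le_mul hVE h2 (by positivity) (avg_nonneg fun _ => ind_nonneg _)
        have b4 : (avg fun x => avg fun y => ind (D' x y)) ≤ lam * avg (fun x => ind (D x)) := by
          nlinarith
        have b5 := mul_le_mul_of_nonneg_left b4 (pow_nonneg hl0 T)
        rw [e1, pow_succ, mul_assoc]
        linarith
  obtain ⟨T, hT⟩ := exists_pow_lt_of_lt_one (show 0 < ε / 2 by positivity) hl1
  obtain ⟨κ, i1, hκ⟩ := claim T
  refine ⟨κ, i1, fun g hg hV D hD => ?_⟩
  have h1 := hκ g hg hV D hD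
  have hd1 : avg (fun x => ind (D x)) ≤ 1 := avg_le_const fun _ => ind_le_one _
  have := mul_le_of_le_one_right (pow_nonneg hl0 T) hd1
  linarith

lemma ins1 {α : Type} [Finite α] [Nonempty α] (H : DHJProp α) (r : α) (η : Type) [Finite η]
    (ε : ℝ) (hε : 0 < ε) :
    ∃ (κ : Type) (_ : Finite κ), ∀ c : ℝ, 0 ≤ c → ∀ g : (κ → Option α) → ℝ, (∀ x, g x ≤ 1) →
      (∀ V : Subspace η (Option α) κ, avg (fun z => g (V z)) ≤ c) →
      ∀ D : (κ → Option α) → Prop, Insens r D → avg (fun x => ind (D x) * g x) ≤ c + ε := by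
  obtain ⟨κ, i1, hκ⟩ := ins0 H r η ε hε
  refine ⟨κ, i1, fun c hc g hg hV D hD => ?_⟩
  have := hκ (fun x => g x - c) (fun x => by linarith [hg x]) (fun V => by
    rw [avg_sub, avg_const]; linarith [hV V]) D hD
  simp only [mul_sub] at this
  rw [avg_sub, avg_mul_right] at this
  have hd1 : avg (fun x => ind (D x)) ≤ 1 := avg_le_const fun _ => ind_le_one _
  nlinarith

lemma multi {α : Type} [Finite α] [Nonempty α] (H : DHJProp α) (S : Finset α) :
    ∀ (η : Type) [Finite η] (ε : ℝ), 0 < ε →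
    ∃ (κ : Type) (_ : Finite κ), ∀ g : (κ → Option α) → ℝ, (∀ x, g x ≤ 1) →
      (∀ V : Subspace η (Option α) κ, avg (fun z => g (V z)) ≤ 0) →
      avg g ≤ ε ∧ ∀ D : α → (κ → Option α) → Prop, (∀ r, Insens r (D r)) →
        avg (fun x => ind (¬ ∀ r ∈ S, D r x) * g x) ≤ ε := by
  classical
  induction S using Finset.induction_on with
  | empty =>
    intro η _ ε hε
    refine ⟨η, inferInstance, fun g hg hV => ⟨?_, fun D hD => ?_⟩⟩
    · exact (hV ⟨Sum.inr, fun i => ⟨i, rfl⟩⟩).trans hε.le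
    · refine avg_le_const fun x => ?_
      rw [ind_false (by simp)]
      linarith
  | insert r S hr ih =>
    intro η _ ε hε
    obtain ⟨κ', _, h'⟩ := ih η (ε / 4) (by positivity)
    obtain ⟨κ, i1, hκ⟩ := ins1 H r κ' (ε / 4) (by positivity)
    refine ⟨κ, i1, fun g hg hV => ?_⟩
    have hU : ∀ V : Subspace κ' (Option α) κ, _ := fun V => h' (fun z => g (V z))
      (fun _ => hg _) (fun U => by
        have := hV (scomp V U)
        simpa only [scomp_apply] using this)
    have key := hκ (ε / 4) (by positivity) g hg (fun V => (hU V).1)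
    constructor
    · have := key (fun _ => True) (fun _ _ _ h => h)
      simp only [ind_true trivial, one_mul] at this
      linarith
    · intro D hD
      have k1 := key _ (hD r).not
      have k2 := hκ (ε / 4) (by positivity) (fun x => ind (¬ ∀ r ∈ S, D r x) * g x) (fun x => by
          have := hg x
          by_cases h : (¬ ∀ r ∈ S, D r x)
          · rw [ind_true h]; linarith
          · rw [ind_false h]; linarith) (fun V => (hU V).2 (fun r z => D r (V z))
            (fun r => (hD r).sub V)) _ (hD r)
      have : ∀ x, ind (¬ ∀ r' ∈ insert r S, D r' x) * g x =
          ind (¬ D r x) * g x + ind (D r x) * (ind (¬ ∀ r ∈ S, D r x) * g x) := by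
        intro x
        rw [Finset.forall_mem_insert, ind_not, ind_not, ind_not, ind_and]
        ring
      rw [avg_congr this, avg_add]
      linarith

end DHJ

namespace DHJ
open Combinatorics

def sext {η α ι : Type} (V : Subspace η α ι) : Subspace η (Option α) ι :=
  ⟨fun i => (V.idxFun i).map some id, fun e => by
    obtain ⟨i, hi⟩ := V.proper e
    exact ⟨i, by simp [hi]⟩⟩

lemma sext_apply {η α ι : Type} (V : Subspace η α ι) (z : η → Option α) (i : ι) :
    sext V z i = (V.idxFun i).elim some z := by
  cases h : V.idxFun i <;> simp [Subspace.apply_def, sext, h]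

lemma firstV {α : Type} [Finite α] [Nonempty α] (M : ℕ) : ∀ (κ : Type) [Finite κ],
    ∃ (ι : Type) (_ : Finite ι), ∀ c : (ι → Option α) → κ, ∃ V : Subspace (Fin M) α ι,
      ∀ (j : Fin M) (z z' : Fin M → Option α), z j = none → z' j = none →
        (∀ i < j, z i ≠ none ∧ z i = z' i) → c (sext V z) = c (sext V z') := by
  induction M with
  | zero =>
    intro κ _
    exact ⟨Unit, inferInstance, fun c => ⟨⟨fun _ => Sum.inl (Classical.arbitrary α),
      fun e => e.elim0⟩, fun j => j.elim0⟩⟩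
  | succ M ih =>
    intro κ _
    obtain ⟨ι₂, _, h2⟩ := ih (α → κ)
    obtain ⟨ι₁, i1, h1⟩ := Subspace.exists_mono_in_high_dimension (Option α) κ ι₂
    refine ⟨Unit ⊕ ι₁, inferInstance, fun c => ?_⟩
    obtain ⟨U, k0, hU⟩ := h1 (fun w => c (Sum.elim (fun _ => none) w))
    obtain ⟨V, hV⟩ := h2 (fun w a => c (Sum.elim (fun _ => some a)
      (fun i => (U.idxFun i).elim (fun b => some (b.getD a)) w)))
    let V' : Subspace (Fin (M + 1)) α (Unit ⊕ ι₁) :=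
      ⟨Sum.elim (fun _ => Sum.inr 0) (fun i => (U.idxFun i).elim
        (fun b => b.elim (Sum.inr 0) Sum.inl) (fun e => (V.idxFun e).map id Fin.succ)), by
        intro e
        refine Fin.cases ?_ (fun e => ?_) e
        · exact ⟨Sum.inl (), rfl⟩
        · obtain ⟨j, hj⟩ := V.proper e
          obtain ⟨i, hi⟩ := U.proper j
          exact ⟨Sum.inr i, by simp [hi, hj]⟩⟩
    have hnone : ∀ z : Fin (M + 1) → Option α, z 0 = none →
        sext V' z = Sum.elim (fun _ => none) (U (sext V fun j => z j.succ)) := by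
      intro z hz
      funext i
      rcases i with i | i
      · simp [sext_apply, V', hz]
      · rw [sext_apply]
        simp only [V', Sum.elim_inr, Subspace.apply_def]
        rcases h : U.idxFun i with b | e
        · cases b <;> simp [hz]
        · simp only [Sum.elim_inr]
          rw [sext_apply]
          cases h3 : V.idxFun e <;> simp
    have hsome : ∀ z : Fin (M + 1) → Option α, ∀ a, z 0 = some a →
        sext V' z = Sum.elim (fun _ => some a) (fun i => (U.idxFun i).elim
          (fun b => some (b.getD a)) (sext V fun j => z j.succ)) := by
      intro z a hz
      funext i
      rcases i with i | i
      · simp [sext_apply, V', hz]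
      · rw [sext_apply]
        simp only [V', Sum.elim_inr]
        rcases h : U.idxFun i with b | e
        · cases b <;> simp [hz]
        · simp only [Sum.elim_inr]
          rw [sext_apply]
          cases h3 : V.idxFun e <;> simp
    refine ⟨V', fun j z z' hz hz' hlt => ?_⟩
    rcases Fin.eq_zero_or_eq_succ j with rfl | ⟨j, rfl⟩
    · rw [hnone z hz, hnone z' hz']
      exact (hU _).trans (hU _).symm
    · obtain ⟨h0, h0'⟩ := hlt 0 (Fin.succ_pos j)
      obtain ⟨a, ha⟩ := Option.ne_none_iff_exists'.1 h0
      rw [hsome z a ha, hsome z' a (h0' ▸ ha)]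
      exact congrFun (hV j (fun i => z i.succ) (fun i => z' i.succ) hz hz'
        (fun i hi => hlt i.succ (Fin.succ_lt_succ_iff.2 hi))) a

lemma sext_scomp {ζ η α ι : Type} (V : Subspace η α ι) (U : Subspace ζ α η) (z : ζ → Option α) :
    sext (scomp V U) z = sext V (sext U z) := by
  funext i
  rw [sext_apply, sext_apply]
  rcases h : V.idxFun i with b | e
  · simp [scomp, h]
  · simp [scomp, h, sext_apply]

lemma firstW {α : Type} [Finite α] [Nonempty α] (κ : Type) [Finite κ] (m : ℕ) :
    ∃ M : ℕ, ∀ c : (Fin M → Option α) → κ,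
      (∀ (j : Fin M) (z z' : Fin M → Option α), z j = none → z' j = none →
        (∀ i < j, z i ≠ none ∧ z i = z' i) → c z = c z') →
      ∃ V : Subspace (Fin m) α (Fin M),
        ∀ (j : Fin m) (z z' : Fin m → Option α), z j = none → z' j = none →
        (∀ i < j, z i ≠ none ∧ z' i ≠ none) → c (sext V z) = c (sext V z') := by
  induction m with
  | zero =>
    exact ⟨0, fun c _ => ⟨⟨fun i => i.elim0, fun e => e.elim0⟩, fun j => j.elim0⟩⟩
  | succ m ih =>
    obtain ⟨M, hM⟩ := ih
    obtain ⟨L, hL⟩ := Subspace.exists_mono_in_high_dimension_fin α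
      ((Fin M → Option α) → κ) Unit
    refine ⟨L + M, fun c hc => ?_⟩
    obtain ⟨l, k0, hl⟩ := hL (fun u w => c (Fin.append (fun i => some (u i)) w))
    have hk : ∀ a w, k0 w = c (Fin.append (fun i => some (l (fun _ => a) i)) w) := by
      intro a w; rw [← hl (fun _ => a)]
    obtain ⟨V, hV⟩ := hM k0 (by
      intro j z z' hz hz' hlt
      rw [hk (Classical.arbitrary α), hk (Classical.arbitrary α)]
      refine hc (Fin.natAdd L j) _ _ (by simpa using hz) (by simpa using hz') ?_
      intro i
      refine Fin.addCases (fun i => ?_) (fun i => ?_) i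
      · intro _; simp
      · intro hi
        simpa using hlt i (by simpa using hi))
    let V' : Subspace (Fin (m + 1)) α (Fin (L + M)) :=
      ⟨Fin.append (fun i => (l.idxFun i).map id (fun _ => 0))
        (fun i => (V.idxFun i).map id Fin.succ), by
        intro e
        refine Fin.cases ?_ (fun e => ?_) e
        · obtain ⟨i, hi⟩ := l.proper ()
          exact ⟨Fin.castAdd M i, by simp [hi]⟩
        · obtain ⟨i, hi⟩ := V.proper e
          exact ⟨Fin.natAdd L i, by simp [hi]⟩⟩
    have e1 : ∀ z i, sext V' z (Fin.castAdd M i) = (l.idxFun i).elim some (fun _ => z 0) := by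
      intro z i
      rw [sext_apply]
      simp only [V', Fin.append_left]
      cases l.idxFun i <;> simp
    have e2 : ∀ z i, sext V' z (Fin.natAdd L i) = sext V (fun j => z j.succ) i := by
      intro z i
      rw [sext_apply, sext_apply]
      simp only [V', Fin.append_right]
      cases V.idxFun i <;> simp
    have hsome : ∀ z a, z 0 = some a →
        sext V' z = Fin.append (fun i => some (l (fun _ => a) i)) (sext V (fun j => z j.succ)) := by
      intro z a hz
      funext i
      refine Fin.addCases (fun i => ?_) (fun i => ?_) i
      · rw [e1, Fin.append_left, Subspace.apply_def]
        cases l.idxFun i <;> simp [hz]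
      · rw [e2, Fin.append_right]
    refine ⟨V', fun j z z' hz hz' hlt => ?_⟩
    rcases Fin.eq_zero_or_eq_succ j with rfl | ⟨j, rfl⟩
    · obtain ⟨j0, hj0, hmin⟩ := (wellFounded_lt (α := Fin L)).has_min
        {i | l.idxFun i = Sum.inr ()} (l.proper ())
      have hj0' : l.idxFun j0 = Sum.inr () := hj0
      refine hc (Fin.castAdd M j0) _ _ (by rw [e1, hj0']; simpa using hz)
        (by rw [e1, hj0']; simpa using hz') ?_
      intro i
      refine Fin.addCases (fun i => ?_) (fun i => ?_) i
      · intro hi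
        rw [e1, e1]
        rcases h : l.idxFun i with b | u
        · simp
        · exact absurd (show i < j0 from Fin.lt_def.2 (Fin.lt_def.1 hi)) (hmin i h)
      · intro hi
        rw [Fin.lt_def] at hi
        simp at hi
        omega
    · obtain ⟨h0, h0'⟩ := hlt 0 (Fin.succ_pos j)
      obtain ⟨a, ha⟩ := Option.ne_none_iff_exists'.1 h0
      obtain ⟨a', ha'⟩ := Option.ne_none_iff_exists'.1 h0'
      rw [hsome z a ha, hsome z' a' ha', ← hk, ← hk]
      exact hV j (fun i => z i.succ) (fun i => z' i.succ) hz hz'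
        (fun i hi => hlt i.succ (Fin.succ_lt_succ_iff.2 hi))

/-- Graham-Rothschild theorem for lines. -/
lemma gr {α : Type} [Finite α] [Nonempty α] (κ : Type) [Finite κ] (η : Type) [Finite η] :
    ∃ (ι : Type) (_ : Finite ι), ∀ c : (ι → Option α) → κ, ∃ V : Subspace η α ι,
      ∀ z z' : η → Option α, (∃ i, z i = none) → (∃ i, z' i = none) →
        c (sext V z) = c (sext V z') := by
  classical
  have := Fintype.ofFinite κ
  have := Fintype.ofFinite η
  set m := Fintype.card κ * Fintype.card η + 1 with hm
  obtain ⟨M, hM⟩ := firstW (α := α) κ m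
  obtain ⟨ι, i1, hι⟩ := firstV (α := α) M κ
  refine ⟨ι, i1, fun c => ?_⟩
  obtain ⟨V₁, hV₁⟩ := hι c
  obtain ⟨V₂, hV₂⟩ := hM (fun z => c (sext V₁ z)) hV₁
  let a0 : α := Classical.arbitrary α
  let f : Fin m → κ := fun j =>
    c (sext V₁ (sext V₂ (fun i => if i = j then none else some a0)))
  have hf : ∀ (j : Fin m) (z : Fin m → Option α), z j = none → (∀ i < j, z i ≠ none) →
      c (sext V₁ (sext V₂ z)) = f j := by
    intro j z hz hlt
    exact hV₂ j _ _ hz (by simp) (fun i hi => ⟨hlt i hi, by simp [hi.ne]⟩)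
  obtain ⟨k, hk⟩ := Fintype.exists_lt_card_fiber_of_mul_lt_card (f := f) (n := Fintype.card η)
    (by simp [hm])
  rw [← Fintype.card_coe] at hk
  obtain ⟨e⟩ := Function.Embedding.nonempty_of_card_le hk.le
  have he : ∀ i, f (e i) = k := fun i => (Finset.mem_filter.1 (e i).2).2
  have hinj : Function.Injective (fun i => (e i : Fin m)) :=
    Subtype.val_injective.comp e.injective
  let V₃ : Subspace η α (Fin m) :=
    ⟨Function.extend (fun i => (e i : Fin m)) Sum.inr (fun _ => Sum.inl a0), fun i =>
      ⟨e i, hinj.extend_apply _ _ _⟩⟩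
  have key : ∀ z : η → Option α, (∃ i, z i = none) →
      c (sext V₁ (sext V₂ (sext V₃ z))) = k := by
    rintro z ⟨i, hi⟩
    have hs : ∀ i, sext V₃ z (e i) = z i := by
      intro i
      rw [sext_apply]
      have : V₃.idxFun (e i) = Sum.inr i :=
        hinj.extend_apply Sum.inr (fun _ => Sum.inl a0) i
      rw [this]; rfl
    obtain ⟨j, hj, hmin⟩ := (wellFounded_lt (α := Fin m)).has_min
      {j | sext V₃ z j = none} ⟨e i, (hs i).trans hi⟩
    rw [hf j _ hj (fun i hi hn => hmin i hn hi)]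
    by_cases hje : ∃ i, (e i : Fin m) = j
    · obtain ⟨i, rfl⟩ := hje
      exact he i
    · exfalso
      have h2 : V₃.idxFun j = Sum.inl a0 :=
        Function.extend_apply' (f := fun i => (e i : Fin m)) Sum.inr (fun _ => Sum.inl a0) j hje
      have h3 : sext V₃ z j = none := hj
      rw [sext_apply, h2] at h3
      simp at h3
  refine ⟨scomp V₁ (scomp V₂ V₃), fun z z' hz hz' => ?_⟩
  rw [sext_scomp, sext_scomp, sext_scomp, sext_scomp, key z hz, key z' hz']

end DHJ

namespace DHJ
open Combinatorics

/-- `A` contains no combinatorial line. -/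
def LF {β ι : Type} (A : (ι → β) → Prop) : Prop := ∀ l : Line β ι, ∃ b, ¬ A (l b)

lemma LF.sub {β ι η : Type} {A : (ι → β) → Prop} (h : LF A) (V : Subspace η β ι) :
    LF (fun z => A (V z)) := by
  intro l
  obtain ⟨b, hb⟩ := h ⟨fun i => (V.idxFun i).elim some l.idxFun, by
    obtain ⟨e, he⟩ := l.proper
    obtain ⟨i, hi⟩ := V.proper e
    exact ⟨i, by simp [hi, he]⟩⟩
  refine ⟨b, fun hA => hb ?_⟩
  convert hA using 1
  funext i
  cases hV : V.idxFun i <;> simp [Subspace.apply_def, hV]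

def idS (η β : Type) : Subspace η β η := ⟨Sum.inr, fun e => ⟨e, rfl⟩⟩

lemma idS_apply {η β : Type} (z : η → β) : idS η β z = z := rfl

lemma LF.vert {β ι κ : Type} {A : (κ ⊕ ι → β) → Prop} (h : LF A) (x : κ → β) :
    LF (fun z => A (Sum.elim x z)) := by
  have := h.sub (DHJ.vert x (idS ι β))
  simpa only [vert_apply, idS_apply] using this

lemma LF.horiz {β ι κ η : Type} {A : (ι ⊕ κ → β) → Prop} (h : LF A) (V : Subspace η β ι)
    (y : κ → β) : LF (fun z => A (Sum.elim (V z) y)) := by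
  have := h.sub (DHJ.horiz V y)
  simpa only [horiz_apply] using this

lemma sext_getD {η α ι : Type} (W : Subspace η α ι) (z : η → Option α) (r : α) :
    (fun i => some ((sext W z i).getD r)) = sext W (fun e => some ((z e).getD r)) := by
  funext i
  rw [sext_apply, sext_apply]
  cases W.idxFun i <;> simp

/-- words all of whose letters are not `none` are rare, even in subspaces -/
lemma rare {α : Type} [Finite α] [Nonempty α] (τ : ℝ) (hτ : 0 < τ) : ∃ N : ℕ,
    ∀ (η₁ ι : Type) [Finite η₁] [Finite ι] (V : Subspace (η₁ ⊕ Fin N) (Option α) ι),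
      avg (fun z => ind (∀ i, V z i ≠ none)) ≤ τ := by
  obtain ⟨N, hN⟩ := exists_pow_lt_of_lt_one hτ
    (avg_ind_lt_one (fun b : Option α => b ≠ none) none (by simp))
  refine ⟨N, fun η₁ ι _ _ V => ?_⟩
  have h1 : avg (fun z => ind (∀ i, V z i ≠ none)) ≤
      avg (fun z : η₁ ⊕ Fin N → Option α => ind (∀ f : Fin N, z (Sum.inr f) ≠ none)) := by
    refine avg_mono fun z => ind_mono fun h f => ?_
    obtain ⟨i, hi⟩ := V.proper (Sum.inr f)
    simpa [Subspace.apply_def, hi] using h i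
  refine h1.trans ?_
  rw [avg_sum_elim]
  refine avg_le_const fun x => ?_
  simp only [Sum.elim_inr]
  have h2 : ∀ y : Fin N → Option α, ind (∀ f, y f ≠ none) = ∏ f, ind (y f ≠ none) :=
    fun y => ind_forall_prod _
  rw [avg_congr h2, avg_pi_prod (fun (_ : Fin N) b => ind (b ≠ none)), Finset.prod_const]
  simpa using hN.le

lemma step {α : Type} [Finite α] [Nonempty α] (H : DHJProp α) : DHJProp (Option α) := by
  by_contra hcon
  rw [DHJProp] at hcon
  push Not at hcon
  obtain ⟨δ₀, hδ₀, hbad⟩ := hcon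
  let S : Set ℝ := {d | ∀ (ι : Type) [Finite ι], ∃ A : (ι → Option α) → Prop,
    LF A ∧ d ≤ avg (fun x => ind (A x))}
  have hS0 : δ₀ ∈ S := by
    intro ι _
    obtain ⟨A, h1, h2⟩ := hbad ι inferInstance
    exact ⟨A, h2, h1⟩
  have hSb : ∀ d ∈ S, d ≤ 1 := by
    intro d hd
    obtain ⟨A, _, h2⟩ := hd Unit
    exact h2.trans (avg_le_const fun x => ind_le_one _)
  have hbdd : BddAbove S := ⟨1, hSb⟩
  set δ := sSup S with hδdef
  have hδ : 0 < δ := hδ₀.trans_le (le_csSup hbdd hS0)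
  have hδ1 : δ ≤ 1 := csSup_le ⟨_, hS0⟩ hSb
  have low : ∀ ε > 0, ∀ (ι : Type) [Finite ι], ∃ A : (ι → Option α) → Prop,
      LF A ∧ δ - ε ≤ avg (fun x => ind (A x)) := by
    intro ε hε ι _
    obtain ⟨d, hd, hlt⟩ := exists_lt_of_lt_csSup ⟨_, hS0⟩ (show δ - ε < sSup S by linarith)
    obtain ⟨A, h1, h2⟩ := hd ι
    exact ⟨A, h1, hlt.le.trans h2⟩
  have up : ∀ ε > 0, ∃ (ι : Type) (_ : Finite ι), ∀ A : (ι → Option α) → Prop,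
      LF A → avg (fun x => ind (A x)) ≤ δ + ε := by
    intro ε hε
    by_contra! hcon
    have : δ + ε ∈ S := by
      intro ι _
      obtain ⟨A, h1, h2⟩ := hcon ι inferInstance
      exact ⟨A, h1, h2.le⟩
    have := le_csSup hbdd this
    linarith
  obtain ⟨ι₀, _, hι₀⟩ := H (δ / 2 / 2) (by positivity)
  set θ := δ / 2 / 2 / (Nat.card (Line α ι₀) + 1) with hθdef
  have hθ : 0 < θ := by positivity
  have hθ1 : θ ≤ 1 := by
    have : θ ≤ δ / 2 / 2 := div_le_self (by positivity) (by simp)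
    linarith
  set τ := δ * θ / 10 with hτdef
  have hτ : 0 < τ := by positivity
  have hτδ : τ ≤ δ / 2 := by
    rw [hτdef]; nlinarith
  obtain ⟨η₁, _, hη₁⟩ := up τ hτ
  obtain ⟨N, hN⟩ := rare (α := α) τ hτ
  have hFα := Fintype.ofFinite α
  obtain ⟨ι, _, hι⟩ := multi H Finset.univ (η₁ ⊕ Fin N) τ hτ
  obtain ⟨ι₁, _, hι₁⟩ := gr (α := α) Prop (ι₀ ⊕ ι)
  have hcard := card_pos' (ι₁ → Option α)
  set ε₃ := τ / Nat.card (ι₁ → Option α) / 2 with hε₃def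
  have hε₃ : 0 < ε₃ := by positivity
  obtain ⟨κ, _, hκ⟩ := up ε₃ hε₃
  obtain ⟨A, hA, hAd⟩ := low ε₃ hε₃ (ι₁ ⊕ κ)
  rw [avg_sum_elim] at hAd
  have hx : ∀ x : ι₁ → Option α, δ - τ ≤ avg fun y : κ → Option α => ind (A (Sum.elim x y)) := by
    intro x
    have h := avg_lower (fun x => hκ _ (hA.vert x)) hAd x
    have h2 : (Nat.card (ι₁ → Option α) : ℝ) * (δ + ε₃ - (δ - ε₃)) = τ := by
      rw [hε₃def]; field_simp; ring
    rw [h2] at h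
    linarith
  let c : (ι₁ → Option α) → Prop := fun x => θ ≤ avg fun y : κ → Option α =>
    ind (∀ r : α, A (Sum.elim (fun i => some ((x i).getD r)) y))
  obtain ⟨W, hW⟩ := hι₁ c
  let a0 : α := Classical.arbitrary α
  obtain ⟨l, hl⟩ := pigeon (fun (l : Line α ι₀) x => ∃ a, x = l a)
    (fun (x : ι₀ → α) (y : κ → Option α) =>
      A (Sum.elim (sext W (Sum.elim (fun i => some (x i)) (fun _ => some a0))) y))
    (show 0 < δ / 2 by positivity)
    (const_le_avg fun x => le_trans (by linarith) (hx _))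
    (fun y hB => by
      obtain ⟨l, hl⟩ := hι₀ _ hB
      exact ⟨l, by rintro x ⟨a, rfl⟩; exact hl a⟩)
  have hc0 : c (sext W (Sum.elim l.idxFun (fun _ => some a0))) := by
    refine hl.trans (avg_mono fun y => ind_mono fun h r => ?_)
    rw [sext_getD]
    convert h _ ⟨r, rfl⟩ using 3
    funext i
    cases i <;> simp
  have hgood : ∀ z : ι₀ ⊕ ι → Option α, (∃ i, z i = none) → c (sext W z) := by
    intro z hz
    rw [hW z (Sum.elim l.idxFun (fun _ => some a0)) hz
      (by obtain ⟨i, hi⟩ := l.proper; exact ⟨Sum.inl i, hi⟩)]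
    exact hc0
  let φ : Subspace ι (Option α) ι₁ :=
    scomp (sext W) (vert (fun _ => some a0) (idS ι (Option α)))
  have hφ : ∀ z, φ z = sext W (Sum.elim (fun _ => some a0) z) := by
    intro z
    simp only [φ, scomp_apply, vert_apply, idS_apply]
  let D : (κ → Option α) → α → (ι → Option α) → Prop := fun y r z =>
    A (Sum.elim (φ (fun i => some ((z i).getD r))) y)
  have hD : ∀ y r, Insens r (D y r) := by
    intro y r z z' hz h
    simpa only [D, hz] using h
  let X : (ι → Option α) → Prop := fun z => ∀ i, z i ≠ none
  have hDX : ∀ z, θ * (1 - ind (X z)) ≤ avg fun y => ind (∀ r, D y r z) := by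
    intro z
    by_cases hX : X z
    · rw [ind_true hX]
      simpa using avg_nonneg fun y => ind_nonneg _
    · rw [ind_false hX, sub_zero, mul_one]
      simp only [X] at hX
      push Not at hX
      obtain ⟨i, hi⟩ := hX
      refine le_trans (hgood (Sum.elim (fun _ => some a0) z) ⟨Sum.inr i, hi⟩)
        (avg_mono fun y => ind_mono fun h r => ?_)
      have := h r
      rw [sext_getD] at this
      simp only [D, hφ]
      convert this using 3
      funext i
      cases i <;> simp
  have hADX : ∀ y z, A (Sum.elim (φ z) y) → (∀ r, D y r z) → X z := by
    intro y z h1 h2 i hi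
    obtain ⟨b, hb⟩ := hA.horiz φ y ⟨fun i => (z i).map some, i, by simp [hi]⟩
    apply hb
    cases b with
    | none =>
      convert h1 using 3
      funext i
      cases h : z i <;> simp [h]
    | some r =>
      convert h2 r using 3
      funext i
      cases h : z i <;> simp [h]
  have hXavg : avg (fun z => ind (X z)) ≤ 2 * τ := by
    have := (hι (fun z => ind (X z) - τ) (fun z => by linarith [ind_le_one (X z)])
      (fun V => by
        rw [avg_sub, avg_const]
        have := hN η₁ ι V
        linarith)).1
    rw [avg_sub, avg_const] at this
    linarith
  have hy : ∀ y, avg (fun z => ind (¬ ∀ r, D y r z) * (ind (A (Sum.elim (φ z) y)) - (δ + τ)))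
      ≤ τ := by
    intro y
    have := (hι (fun z => ind (A (Sum.elim (φ z) y)) - (δ + τ))
      (fun z => by linarith [ind_le_one (A (Sum.elim (φ z) y))])
      (fun V => by
        rw [avg_sub, avg_const, avg_sum_elim, avg_comm]
        have : ∀ w : Fin N → Option α, (avg fun x : η₁ → Option α =>
            ind (A (Sum.elim (φ (V (Sum.elim x w))) y))) ≤ δ + τ := by
          intro w
          refine hη₁ (fun x => A (Sum.elim (φ (V (Sum.elim x w))) y)) ?_
          have h3 := ((hA.horiz φ y).sub V).horiz (idS η₁ (Option α)) w
          simpa only [idS_apply] using h3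
        have := avg_le_const this
        linarith)).2 (D y) (hD y)
    simpa using this
  have h1 : (avg fun z => avg fun y =>
      ind (¬ ∀ r, D y r z) * (ind (A (Sum.elim (φ z) y)) - (δ + τ))) ≤ τ := by
    rw [avg_comm]
    exact avg_le_const hy
  have h2 : ∀ z, (-2 * τ + δ * θ) - (1 + δ * θ) * ind (X z) ≤ avg fun y =>
      ind (¬ ∀ r, D y r z) * (ind (A (Sum.elim (φ z) y)) - (δ + τ)) := by
    intro z
    have h3 : (avg fun y => (ind (A (Sum.elim (φ z) y)) - (ind (X z) + (δ + τ))) +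
        δ * ind (∀ r, D y r z)) ≤ avg fun y =>
        ind (¬ ∀ r, D y r z) * (ind (A (Sum.elim (φ z) y)) - (δ + τ)) := by
      refine avg_mono fun y => ?_
      rw [ind_not]
      have h4 : ind (A (Sum.elim (φ z) y)) * ind (∀ r, D y r z) ≤ ind (X z) := by
        rw [← ind_and]
        exact ind_mono fun h => hADX y z h.1 h.2
      have h5 := ind_nonneg (∀ r, D y r z)
      nlinarith [mul_nonneg hτ.le h5]
    rw [avg_add, avg_sub, avg_const, avg_mul_left] at h3
    have h4 := hx (φ z)
    have h5 := mul_le_mul_of_nonneg_left (hDX z) hδ.le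
    nlinarith
  have h3 := (avg_mono h2).trans h1
  rw [avg_sub, avg_const, avg_mul_left] at h3
  have h4 : 0 ≤ δ * θ := by positivity
  have h5 : δ * θ ≤ 1 := mul_le_one₀ hδ1 hθ.le hθ1
  have h6 : (1 + δ * θ) * avg (fun z => ind (X z)) ≤ 2 * (2 * τ) := by
    have h0 : 0 ≤ avg (fun z => ind (X z)) := avg_nonneg fun _ => ind_nonneg _
    nlinarith
  have h7 : δ * θ = 10 * τ := by rw [hτdef]; ring
  linarith

theorem dhj (α : Type) [Finite α] : DHJProp α := by
  refine Finite.induction_empty_option (P := fun α => ∀ [Finite α], DHJProp α) ?_ ?_ ?_ α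
  · intro α α' e h _ δ hδ
    have := Finite.of_equiv _ e.symm
    obtain ⟨ι, i1, hι⟩ := h δ hδ
    refine ⟨ι, i1, fun A hA => ?_⟩
    obtain ⟨l, hl⟩ := hι (fun x => A (e ∘ x)) (by
      rw [← avg_equiv (Equiv.arrowCongr (Equiv.refl ι) e)] at hA
      exact hA)
    refine ⟨l.map e, fun a => ?_⟩
    obtain ⟨a, rfl⟩ := e.surjective a
    rw [Line.map_apply]
    exact hl a
  · intro _ δ hδ
    exact ⟨Unit, inferInstance, fun A _ => ⟨Line.diagonal _ _, fun a => a.elim⟩⟩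
  · intro α _ h _
    rcases isEmpty_or_nonempty α with he | hne
    · intro δ hδ
      refine ⟨Unit, inferInstance, fun A hA => ?_⟩
      obtain ⟨x, hx⟩ := exists_avg_le (fun x : Unit → Option α => ind (A x))
      have hAx : A x := by
        by_contra hcon
        rw [ind_false hcon] at hx
        linarith
      refine ⟨Line.diagonal _ _, fun a => ?_⟩
      convert hAx using 1
      exact Subsingleton.elim _ _
    · exact step h

end DHJ

namespace DHJ

lemma abs_ratCoeff_neg (j : ℕ) : |ratCoeff (-((j : ℤ) + 1))| = 1 / ((j + 2).factorial : ℚ) := by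
  have h : (-(-((j : ℤ) + 1))).toNat = j + 1 := by omega
  rw [ratCoeff, if_pos (by omega), h, abs_div, abs_pow]
  simp

lemma abs_ratCoeff_nat (j : ℕ) : |ratCoeff (j : ℤ)| = (j.factorial : ℚ) := by
  rw [ratCoeff, if_neg (by omega), abs_mul, abs_pow]
  simp

lemma ratCoeff_double (t : ℤ) (ht : t ≠ 0) : 2 * |ratCoeff t| ≤ |ratCoeff (t + 1)| := by
  rcases lt_or_gt_of_ne ht with h | h
  · obtain ⟨j, rfl⟩ : ∃ j : ℕ, t = -((j : ℤ) + 1) := ⟨(-t - 1).toNat, by omega⟩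
    rw [abs_ratCoeff_neg]
    rcases j with _ | j
    · have := abs_ratCoeff_nat 0
      simp at this
      simp [this, Nat.factorial]
    · have e : -(((j + 1 : ℕ) : ℤ) + 1) + 1 = -((j : ℤ) + 1) := by push_cast; ring
      rw [e, abs_ratCoeff_neg, show j + 1 + 2 = (j + 2) + 1 by ring, Nat.factorial_succ (j + 2)]
      have h1 : (0 : ℚ) < ((j + 2).factorial : ℚ) := by positivity
      push_cast
      rw [mul_one_div, div_le_div_iff₀ (by positivity) h1]
      nlinarith [(Nat.cast_nonneg j : (0 : ℚ) ≤ j)]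
  · obtain ⟨j, rfl⟩ : ∃ j : ℕ, t = ((j + 1 : ℕ) : ℤ) := ⟨(t - 1).toNat, by omega⟩
    have e : ((j + 1 : ℕ) : ℤ) + 1 = ((j + 1 + 1 : ℕ) : ℤ) := by push_cast; ring
    rw [e, abs_ratCoeff_nat, abs_ratCoeff_nat, Nat.factorial_succ (j + 1)]
    have h1 : (0 : ℚ) < ((j + 1).factorial : ℚ) := by positivity
    push_cast
    nlinarith [(Nat.cast_nonneg j : (0 : ℚ) ≤ j)]

lemma ratCoeff_mono : Monotone (fun t : ℤ => |ratCoeff t|) := by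
  refine monotone_int_of_le_succ fun t => ?_
  by_cases ht : t = 0
  · subst ht
    have h0 := abs_ratCoeff_nat 0
    have h1 := abs_ratCoeff_nat 1
    simp at h0 h1
    simp [h0, h1]
  · have := ratCoeff_double t ht
    have := abs_nonneg (ratCoeff t)
    linarith

lemma ratCoeff_pos (t : ℤ) : 0 < |ratCoeff t| := by
  rw [abs_pos, ratCoeff]
  split_ifs <;> positivity

lemma ratCoeff_dom (F : Finset ℤ) : (∀ t ∈ F, t ≠ 0) → ∀ m, (∀ t ∈ F, t < m) →
    ∑ t ∈ F, |ratCoeff t| < |ratCoeff m| := by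
  induction F using Finset.induction_on_max with
  | empty => intro _ m _; simpa using ratCoeff_pos m
  | insert a s ha ih =>
    intro h0 m hm
    rw [Finset.sum_insert (fun h => lt_irrefl _ (ha a h))]
    have h1 := ih (fun t ht => h0 t (Finset.mem_insert_of_mem ht)) a ha
    have h2 := ratCoeff_double a (h0 a (Finset.mem_insert_self _ _))
    have h3 : |ratCoeff (a + 1)| ≤ |ratCoeff m| :=
      ratCoeff_mono (hm a (Finset.mem_insert_self _ _))
    linarith

lemma sum_ratCoeff_ne (F : Finset ℤ) (hF : F.Nonempty) (h0 : ∀ t ∈ F, t ≠ 0) :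
    ∑ t ∈ F, ratCoeff t ≠ 0 := by
  intro h
  have hm := F.max'_mem hF
  rw [← Finset.add_sum_erase _ _ hm] at h
  have h1 := ratCoeff_dom (F.erase (F.max' hF)) (fun t ht => h0 t (Finset.mem_of_mem_erase ht))
    (F.max' hF) (fun t ht => lt_of_le_of_ne (F.le_max' t (Finset.mem_of_mem_erase ht))
      (Finset.ne_of_mem_erase ht))
  have h2 := Finset.abs_sum_le_sum_abs ratCoeff (F.erase (F.max' hF))
  rw [eq_neg_of_add_eq_zero_left h, abs_neg] at h1
  linarith

end DHJ

/-- Density theorem for rationals viewed as located words: let `k ∈ ℕ` and, for each `n`,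
let `t^n_1 < … < t^n_n` be nonzero integers with `|t^n_j| ≥ k`, and let
`ℚ(t^n_1,…,t^n_n,k) = {Σ_j q_j·c_{t^n_j} : 1 ≤ q_j ≤ k}`. If `A ⊆ ℚ` satisfies
`limsup_n |A ∩ ℚ(t^n_1,…,t^n_n,k)| / k^n > 0`, then there are `n`, disjoint sets
`F₁, F₂ ⊆ {t^n_1,…,t^n_n}` with `F₂` nonempty, and coefficients `1 ≤ w_s ≤ k` on `F₁`,
such that with `q = Σ_{s∈F₂} c_s ≠ 0` and `p = q + Σ_{s∈F₁} w_s·c_s` one has `p ∈ A` and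
`p + i·q ∈ A` for every `i = 0, 1, …, k−1`. -/
theorem density_located_words (k : ℕ) (t : (n : ℕ) → Fin n → ℤ)
    (hmono : ∀ n, StrictMono (t n)) (ht0 : ∀ n j, t n j ≠ 0)
    (htk : ∀ n j, (k : ℤ) ≤ |t n j|)
    (A : Set ℚ)
    (hA : 0 < Filter.limsup (fun n =>
      (Set.ncard (A ∩ {x : ℚ | ∃ q : Fin n → ℕ, (∀ j, 1 ≤ q j ∧ q j ≤ k) ∧
        x = ∑ j, (q j : ℚ) * ratCoeff (t n j)}) : ℝ) / (k : ℝ) ^ n) Filter.atTop) :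
    ∃ n : ℕ, ∃ F₁ F₂ : Finset ℤ, Disjoint F₁ F₂ ∧ F₂.Nonempty ∧
      (∀ s ∈ F₁ ∪ F₂, ∃ j : Fin n, s = t n j) ∧
      ∃ w : ℤ → ℕ, (∀ s ∈ F₁, 1 ≤ w s ∧ w s ≤ k) ∧
        ∃ q p : ℚ, q = ∑ s ∈ F₂, ratCoeff s ∧
          p = q + ∑ s ∈ F₁, (w s : ℚ) * ratCoeff s ∧
          q ≠ 0 ∧ p ∈ A ∧ ∀ i : ℕ, i < k → p + (i : ℚ) * q ∈ A := by
  classical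
  rcases Nat.eq_zero_or_pos k with rfl | hk
  · exfalso
    have h : (fun n : ℕ => (Set.ncard (A ∩ {x : ℚ | ∃ q : Fin n → ℕ,
        (∀ j, 1 ≤ q j ∧ q j ≤ 0) ∧ x = ∑ j, (q j : ℚ) * ratCoeff (t n j)}) : ℝ) /
        ((0 : ℕ) : ℝ) ^ n) =ᶠ[Filter.atTop] fun _ => (0 : ℝ) := by
      filter_upwards [Filter.eventually_gt_atTop 0] with n hn
      simp [hn.ne']
    rw [Filter.limsup_congr h, Filter.limsup_const] at hA
    exact lt_irrefl _ hA
  have : NeZero k := ⟨hk.ne'⟩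
  set L := Filter.limsup (fun n =>
      (Set.ncard (A ∩ {x : ℚ | ∃ q : Fin n → ℕ, (∀ j, 1 ≤ q j ∧ q j ≤ k) ∧
        x = ∑ j, (q j : ℚ) * ratCoeff (t n j)}) : ℝ) / (k : ℝ) ^ n) Filter.atTop with hL
  obtain ⟨ι, _, hι⟩ := DHJ.dhj (Fin k) (L / 2) (by linarith)
  have hfreq := Filter.frequently_lt_of_lt_limsup
    (Filter.isCoboundedUnder_le_of_le Filter.atTop (x := (0 : ℝ)) (fun n => by positivity))
    (show L / 2 < L by linarith)
  obtain ⟨n, hn1, hn2⟩ := (hfreq.and_eventually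
    (Filter.eventually_ge_atTop (Nat.card ι))).exists
  have := Fintype.ofFinite ι
  obtain ⟨e⟩ : Nonempty (ι ↪ Fin n) := Function.Embedding.nonempty_of_card_le (by
    simpa [Nat.card_eq_fintype_card] using hn2)
  let f : (Fin n → Fin k) → ℚ := fun x => ∑ j, ((x j : ℕ) + 1 : ℚ) * ratCoeff (t n j)
  have hB : L / 2 ≤ avg (fun x : Fin n → Fin k => ind (f x ∈ A)) := by
    refine hn1.le.trans ?_
    rw [DHJ.avg_eq]
    simp only [Fintype.card_pi, Fintype.card_fin, Finset.prod_const, Finset.card_univ]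
    push_cast
    gcongr
    have h1 : (∑ x : Fin n → Fin k, ind (f x ∈ A)) =
        ((Finset.univ.filter fun x => f x ∈ A).card : ℝ) := by
      rw [Finset.card_filter]
      push_cast
      exact Finset.sum_congr rfl fun x _ => by by_cases h : f x ∈ A <;> simp [ind, h]
    rw [h1]
    norm_cast
    refine le_trans ?_ (Finset.card_image_le (f := f))
    rw [← Set.ncard_coe_finset]
    refine Set.ncard_le_ncard ?_ (Finset.finite_toSet _)
    rintro x ⟨hxA, q, hq, rfl⟩
    have hfx : f (fun j => ⟨q j - 1, by have := hq j; omega⟩) =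
        ∑ j, (q j : ℚ) * ratCoeff (t n j) := by
      refine Finset.sum_congr rfl fun j _ => ?_
      congr 1
      have h2 : q j - 1 + 1 = q j := by have := hq j; omega
      exact_mod_cast h2
    rw [Finset.mem_coe, Finset.mem_image]
    refine ⟨_, ?_, hfx⟩
    rw [Finset.mem_filter, hfx]
    exact ⟨Finset.mem_univ _, hxA⟩
  obtain ⟨l, hl, -⟩ := DHJ.dhj_emb hι e e.injective (fun x => f x ∈ A) hB
  have hinj := (hmono n).injective
  let w : ℤ → ℕ := Function.extend (t n) (fun j => (l.idxFun j).elim 0 (fun a => (a : ℕ) + 1)) 0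
  have hw : ∀ j, w (t n j) = (l.idxFun j).elim 0 (fun a => (a : ℕ) + 1) :=
    fun j => hinj.extend_apply _ _ _
  let G₂ : Finset (Fin n) := Finset.univ.filter fun j => l.idxFun j = none
  let G₁ : Finset (Fin n) := Finset.univ.filter fun j => ¬ l.idxFun j = none
  have hne : (G₂.image (t n)).Nonempty := by
    obtain ⟨j, hj⟩ := l.proper
    exact ⟨t n j, Finset.mem_image_of_mem _ (by simp [G₂, hj])⟩
  have hAP : ∀ i : ℕ, i < k → (∑ s ∈ G₂.image (t n), ratCoeff s +
      ∑ s ∈ G₁.image (t n), (w s : ℚ) * ratCoeff s) +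
      (i : ℚ) * ∑ s ∈ G₂.image (t n), ratCoeff s ∈ A := by
    intro i hi
    convert hl ⟨i, hi⟩ using 1
    rw [Finset.sum_image hinj.injOn, Finset.sum_image hinj.injOn]
    have h3 : f (l ⟨i, hi⟩) = ∑ j ∈ G₂, ((l ⟨i, hi⟩ j : ℕ) + 1 : ℚ) * ratCoeff (t n j) +
        ∑ j ∈ G₁, ((l ⟨i, hi⟩ j : ℕ) + 1 : ℚ) * ratCoeff (t n j) :=
      (Finset.sum_filter_add_sum_filter_not _ _ _).symm
    have h4 : ∑ j ∈ G₂, ((l ⟨i, hi⟩ j : ℕ) + 1 : ℚ) * ratCoeff (t n j) =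
        ((i : ℚ) + 1) * ∑ j ∈ G₂, ratCoeff (t n j) := by
      rw [Finset.mul_sum]
      refine Finset.sum_congr rfl fun j hj => ?_
      have hj' : l.idxFun j = none := (Finset.mem_filter.1 hj).2
      simp [hj']
    have h5 : ∑ j ∈ G₁, ((l ⟨i, hi⟩ j : ℕ) + 1 : ℚ) * ratCoeff (t n j) =
        ∑ j ∈ G₁, (w (t n j) : ℚ) * ratCoeff (t n j) := by
      refine Finset.sum_congr rfl fun j hj => ?_
      obtain ⟨a, ha⟩ := Option.ne_none_iff_exists'.1 (Finset.mem_filter.1 hj).2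
      rw [hw]
      simp [ha]
    rw [h3, h4, h5]
    ring
  refine ⟨n, G₁.image (t n), G₂.image (t n), ?_, hne, ?_, w, ?_, _, _, rfl, rfl, ?_, ?_, hAP⟩
  · rw [Finset.disjoint_left]
    intro s h1 h2
    obtain ⟨j, hj, rfl⟩ := Finset.mem_image.1 h1
    obtain ⟨j', hj', he⟩ := Finset.mem_image.1 h2
    obtain rfl := hinj he
    exact (Finset.mem_filter.1 hj).2 (Finset.mem_filter.1 hj').2
  · intro s hs
    rcases Finset.mem_union.1 hs with h | h <;>
    · obtain ⟨j, _, rfl⟩ := Finset.mem_image.1 h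
      exact ⟨j, rfl⟩
  · intro s hs
    obtain ⟨j, hj, rfl⟩ := Finset.mem_image.1 hs
    obtain ⟨a, ha⟩ := Option.ne_none_iff_exists'.1 (Finset.mem_filter.1 hj).2
    rw [hw, ha]
    simp only [Option.elim_some]
    have := a.2
    omega
  · refine DHJ.sum_ratCoeff_ne _ hne fun s hs => ?_
    obtain ⟨j, _, rfl⟩ := Finset.mem_image.1 hs
    exact ht0 n j
  · simpa using hAP 0 hk
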